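/- arXiv:1903.10004 — 4 statements merged into one kernel-verified Lean document; each statement's English description precedes it below -/
import Mathlib

section
/- Every derivation Y of the ℝ-algebra C^∞(ℝⁿ, ℝ) into itself is a vector field: for every F ∈ C^∞(ℝⁿ, ℝ) and every x ∈ ℝⁿ, (Y F)(x) = Σ_{i=1}^{n} (Y prᵢ)(x) · (∂F/∂xⁱ)(x), where prᵢ : ℝⁿ → ℝ is the i-th coordinate function; that is, Y = Σ_{i=1}^{n} (Y prᵢ) ∂/∂xⁱ. -/
/-- A (global) derivation of the ℝ-algebra `C^∞(ℝⁿ, ℝ)` into itself: an ℝ-linear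
map `Y : C^∞(ℝⁿ, ℝ) → C^∞(ℝⁿ, ℝ)` satisfying Leibniz's rule. -/
def IsDerivationRn {n : ℕ}
    (Y : ((Fin n → ℝ) → ℝ) → ((Fin n → ℝ) → ℝ)) : Prop :=
  (∀ f : (Fin n → ℝ) → ℝ, ContDiff ℝ (⊤ : ℕ∞) f → ContDiff ℝ (⊤ : ℕ∞) (Y f)) ∧
  (∀ f g : (Fin n → ℝ) → ℝ, ContDiff ℝ (⊤ : ℕ∞) f → ContDiff ℝ (⊤ : ℕ∞) g →
    Y (f + g) = Y f + Y g) ∧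
  (∀ (c : ℝ) (f : (Fin n → ℝ) → ℝ), ContDiff ℝ (⊤ : ℕ∞) f → Y (c • f) = c • Y f) ∧
  (∀ f g : (Fin n → ℝ) → ℝ, ContDiff ℝ (⊤ : ℕ∞) f → ContDiff ℝ (⊤ : ℕ∞) g →
    Y (f * g) = Y f * g + f * Y g)

theorem contDiff_param_integral {H : Type} [NormedAddCommGroup H] [NormedSpace ℝ H]
    [FiniteDimensional ℝ H] (k : ℕ) : ∀ {E : Type} [NormedAddCommGroup E] [NormedSpace ℝ E]
    [CompleteSpace E] (G : H → ℝ → E),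
    ContDiff ℝ k (Function.uncurry G) → ContDiff ℝ k (fun x => ∫ t in (0:ℝ)..1, G x t) := by
  induction k with
  | zero =>
    intro E _ _ _ G hG
    simp only [Nat.cast_zero, contDiff_zero] at hG ⊢
    exact intervalIntegral.continuous_parametric_intervalIntegral_of_continuous' hG 0 1
  | succ k ih =>
    intro E _ _ _ G hG
    set G' : H → ℝ → (H →L[ℝ] E) := fun x t =>
      (fderiv ℝ (Function.uncurry G) (x, t)).comp (ContinuousLinearMap.inl ℝ H ℝ) with hG'
    have hd : ContDiff ℝ k (fderiv ℝ (Function.uncurry G)) :=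
      hG.fderiv_right (by push_cast; exact le_rfl)
    have hG'c : ContDiff ℝ k (Function.uncurry G') := hd.clm_comp contDiff_const
    have hcont : Continuous (Function.uncurry G) := hG.continuous
    have hcont' : Continuous (Function.uncurry G') := hG'c.continuous
    have hdiff : Differentiable ℝ (Function.uncurry G) :=
      hG.differentiable (by exact_mod_cast Nat.succ_ne_zero k)
    have key : ∀ x₀, HasFDerivAt (fun x => ∫ t in (0:ℝ)..1, G x t)
        (∫ t in (0:ℝ)..1, G' x₀ t) x₀ := by
      intro x₀
      have : ProperSpace H := FiniteDimensional.proper ℝ H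
      obtain ⟨C, hC⟩ := ((isCompact_closedBall x₀ 1).prod
        (isCompact_Icc (a := (0:ℝ)) (b := 1))).exists_bound_of_continuousOn hcont'.continuousOn
      refine intervalIntegral.hasFDerivAt_integral_of_dominated_of_fderiv_le
        (F := G) (F' := G') (bound := fun _ => C)
        (Metric.closedBall_mem_nhds x₀ one_pos) ?_ ?_ ?_ ?_ ?_ ?_
      · exact Filter.Eventually.of_forall fun x =>
          (hcont.comp (Continuous.prodMk_right x)).aestronglyMeasurable
      · exact (hcont.comp (Continuous.prodMk_right x₀)).intervalIntegrable _ _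
      · exact (hcont'.comp (Continuous.prodMk_right x₀)).aestronglyMeasurable
      · refine Filter.Eventually.of_forall fun t ht x hx => hC (x, t) ⟨hx, ?_⟩
        rw [Set.uIoc_of_le zero_le_one] at ht
        exact ⟨ht.1.le, ht.2⟩
      · exact intervalIntegrable_const
      · refine Filter.Eventually.of_forall fun t _ x _ => ?_
        have h1 : HasFDerivAt (fun e : H => (e, t)) (ContinuousLinearMap.inl ℝ H ℝ) x :=
          hasFDerivAt_prodMk_left x t
        exact HasFDerivAt.comp (g := Function.uncurry G) x (hdiff (x, t)).hasFDerivAt h1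
    have hfd : fderiv ℝ (fun x => ∫ t in (0:ℝ)..1, G x t) = fun x => ∫ t in (0:ℝ)..1, G' x t :=
      funext fun x => (key x).fderiv
    push_cast
    rw [contDiff_succ_iff_fderiv, hfd]
    refine ⟨fun x => (key x).differentiableAt, ?_, ih G' hG'c⟩
    intro h
    exact absurd h (by simp)

theorem hadamard_Rn {n : ℕ} (F : (Fin n → ℝ) → ℝ) (hF : ContDiff ℝ (⊤ : ℕ∞) F)
    (x : Fin n → ℝ) : ∃ g : Fin n → (Fin n → ℝ) → ℝ,
      (∀ i, ContDiff ℝ (⊤ : ℕ∞) (g i)) ∧ (∀ i, g i x = fderiv ℝ F x (Pi.single i 1)) ∧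
      ∀ y, F y = F x + ∑ i, (y i - x i) * g i y := by
  have hd : ContDiff ℝ (⊤ : ℕ∞) (fderiv ℝ F) := (contDiff_infty_iff_fderiv.1 hF).2
  have hG : ∀ i, ContDiff ℝ (⊤ : ℕ∞) (Function.uncurry fun (y : Fin n → ℝ) (t : ℝ) =>
      fderiv ℝ F (x + t • (y - x)) (Pi.single i 1)) := by
    intro i
    refine ContDiff.clm_apply (hd.comp ?_) contDiff_const
    exact contDiff_const.add (contDiff_snd.smul (contDiff_fst.sub contDiff_const))
  refine ⟨fun i y => ∫ t in (0:ℝ)..1, fderiv ℝ F (x + t • (y - x)) (Pi.single i 1),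
    fun i => ?_, fun i => ?_, fun y => ?_⟩
  · rw [contDiff_infty]
    intro k
    exact contDiff_param_integral k _ (contDiff_infty.1 (hG i) k)
  · simp
  · have hcont : ∀ i, Continuous fun t : ℝ =>
        fderiv ℝ F (x + t • (y - x)) (Pi.single i 1) := fun i =>
      (hG i).continuous.comp (Continuous.prodMk_right y)
    have hder : ∀ t : ℝ, HasDerivAt (fun t : ℝ => F (x + t • (y - x)))
        (∑ i, (y i - x i) * fderiv ℝ F (x + t • (y - x)) (Pi.single i 1)) t := by
      intro t
      have h1 : HasDerivAt (fun t : ℝ => x + t • (y - x)) (y - x) t := by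
        simpa using ((hasDerivAt_id t).smul_const (y - x)).const_add x
      have h2 := ((contDiff_infty_iff_fderiv.1 hF).1
        (x + t • (y - x))).hasFDerivAt.comp_hasDerivAt t h1
      have h3 : ∑ i, (y i - x i) * fderiv ℝ F (x + t • (y - x)) (Pi.single i 1)
          = fderiv ℝ F (x + t • (y - x)) (y - x) := by
        have h4 : y - x = ∑ i, (y i - x i) • (Pi.single i 1 : Fin n → ℝ) := by
          ext j
          simp [Finset.sum_apply, Pi.single_apply]
        generalize fderiv ℝ F (x + t • (y - x)) = L
        rw [h4, map_sum]
        simp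
      rw [h3]
      exact h2
    have hint := intervalIntegral.integral_eq_sub_of_hasDerivAt (a := 0) (b := 1)
      (fun t _ => hder t) (Continuous.intervalIntegrable
        (continuous_finsetSum _ fun i _ => continuous_const.mul (hcont i)) _ _)
    rw [intervalIntegral.integral_finsetSum fun i _ =>
      ((hcont i).intervalIntegrable 0 1).const_mul (y i - x i)] at hint
    simp only [intervalIntegral.integral_const_mul, one_smul, zero_smul, add_zero,
      add_sub_cancel] at hint
    rw [hint]
    ring

/-- every derivation `Y` of `C^∞(ℝⁿ, ℝ)` is a vector field:
`(Y F)(x) = Σᵢ (Y prᵢ)(x) · (∂F/∂xⁱ)(x)`, i.e. `Y = Σᵢ (Y prᵢ) ∂/∂xⁱ`. -/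
theorem derivationRn_is_vectorField {n : ℕ}
    (Y : ((Fin n → ℝ) → ℝ) → ((Fin n → ℝ) → ℝ)) (hY : IsDerivationRn Y)
    (F : (Fin n → ℝ) → ℝ) (hF : ContDiff ℝ (⊤ : ℕ∞) F) (x : Fin n → ℝ) :
    Y F x = ∑ i : Fin n, Y (fun y => y i) x * fderiv ℝ F x (Pi.single i 1) := by
  obtain ⟨-, hadd, hsmul, hmul⟩ := hY
  obtain ⟨g, hg, hgx, hFg⟩ := hadamard_Rn F hF x
  have h1c : ContDiff ℝ (⊤ : ℕ∞) (1 : (Fin n → ℝ) → ℝ) := contDiff_const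
  have h0c : ContDiff ℝ (⊤ : ℕ∞) (0 : (Fin n → ℝ) → ℝ) := contDiff_const
  have hY1 : Y 1 = 0 := by
    have h := hmul 1 1 h1c h1c
    simpa using h
  have hY0 : Y 0 = 0 := by
    have h := hsmul 0 0 h0c
    simpa using h
  have hsum : ∀ (s : Finset (Fin n)) (f : Fin n → (Fin n → ℝ) → ℝ),
      (∀ i, ContDiff ℝ (⊤ : ℕ∞) (f i)) →
      ContDiff ℝ (⊤ : ℕ∞) (∑ i ∈ s, f i) ∧ Y (∑ i ∈ s, f i) = ∑ i ∈ s, Y (f i) := by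
    intro s f hf
    induction s using Finset.induction_on with
    | empty => simpa using ⟨h0c, hY0⟩
    | insert a s ha ih =>
      rw [Finset.sum_insert ha, Finset.sum_insert ha]
      exact ⟨(hf a).add ih.1, by rw [hadd _ _ (hf a) ih.1, ih.2]⟩
  have hpr : ∀ i : Fin n, ContDiff ℝ (⊤ : ℕ∞) (fun y : Fin n → ℝ => y i) :=
    fun i => contDiff_apply ℝ ℝ i
  have hcc : ∀ c : ℝ, ContDiff ℝ (⊤ : ℕ∞) (c • (1 : (Fin n → ℝ) → ℝ)) :=
    fun c => h1c.const_smul c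
  have hp : ∀ i : Fin n, ContDiff ℝ (⊤ : ℕ∞)
      ((fun y : Fin n → ℝ => y i) + (-x i) • (1 : (Fin n → ℝ) → ℝ)) :=
    fun i => (hpr i).add (hcc _)
  have hFe : F = F x • (1 : (Fin n → ℝ) → ℝ) + ∑ i,
      ((fun y : Fin n → ℝ => y i) + (-x i) • (1 : (Fin n → ℝ) → ℝ)) * g i := by
    funext y
    rw [hFg y]
    simp [Finset.sum_apply, sub_eq_add_neg]
  obtain ⟨hsc, hsY⟩ := hsum Finset.univ
    (fun i => ((fun y : Fin n → ℝ => y i) + (-x i) • (1 : (Fin n → ℝ) → ℝ)) * g i)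
    (fun i => (hp i).mul (hg i))
  have hYF : Y F = ∑ i,
      Y (((fun y : Fin n → ℝ => y i) + (-x i) • (1 : (Fin n → ℝ) → ℝ)) * g i) := by
    conv_lhs => rw [hFe]
    rw [hadd _ _ (hcc _) hsc, hsmul _ _ h1c, hY1, hsY]
    simp
  rw [hYF, Finset.sum_apply]
  refine Finset.sum_congr rfl fun i _ => ?_
  rw [hmul _ _ (hp i) (hg i), hadd _ _ (hpr i) (hcc _), hsmul _ _ h1c, hY1]
  simp [hgx]
end

section
/- Let S ⊆ ℝⁿ and let X be a derivation of C^∞(S). Then for every C^∞ function F : ℝⁿ → ℝ and every x ∈ S, X(F|_S)(x) = Σ_{i=1}^{n} X(xⁱ|_S)(x) · (∂F/∂xⁱ)(x), where xⁱ|_S denotes the restriction to S of the i-th coordinate function on ℝⁿ and F|_S the restriction of F to S. -/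
/-- A function `f : S → ℝ` on a subset `S ⊆ ℝⁿ` is smooth if, for every `x ∈ S`,
there are an open set `U ⊆ ℝⁿ` containing `x` and a `C^∞` function `F : ℝⁿ → ℝ`
agreeing with `f` on `U ∩ S`. -/
def SmoothOnSet {n : ℕ} (S : Set (Fin n → ℝ)) (f : S → ℝ) : Prop :=
  ∀ x : S, ∃ U : Set (Fin n → ℝ), IsOpen U ∧ (x : Fin n → ℝ) ∈ U ∧
    ∃ F : (Fin n → ℝ) → ℝ, ContDiff ℝ (⊤ : ℕ∞) F ∧
      ∀ y : S, (y : Fin n → ℝ) ∈ U → F y = f y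

/-- A (global) derivation of `C^∞(S)`: an ℝ-linear map `X : C^∞(S) → C^∞(S)`
satisfying Leibniz's rule. -/
def IsDerivationOn {n : ℕ} (S : Set (Fin n → ℝ))
    (X : (S → ℝ) → (S → ℝ)) : Prop :=
  (∀ f : S → ℝ, SmoothOnSet S f → SmoothOnSet S (X f)) ∧
  (∀ f g : S → ℝ, SmoothOnSet S f → SmoothOnSet S g → X (f + g) = X f + X g) ∧
  (∀ (c : ℝ) (f : S → ℝ), SmoothOnSet S f → X (c • f) = c • X f) ∧
  (∀ f g : S → ℝ, SmoothOnSet S f → SmoothOnSet S g →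
    X (f * g) = X f * g + f * X g)

open Set Filter Topology in
theorem contDiff_param_aux {E : Type} [NormedAddCommGroup E] [NormedSpace ℝ E] [ProperSpace E]
    (m : ℕ) : ∀ {F : Type} [NormedAddCommGroup F] [NormedSpace ℝ F] [CompleteSpace F]
    (G : E × ℝ → F), ContDiff ℝ m G → ContDiff ℝ m (fun y => ∫ t in (0:ℝ)..1, G (y, t)) := by
  induction m with
  | zero =>
    intro F _ _ _ G hG
    have hc : Continuous G := hG.continuous
    exact contDiff_zero.2
      (intervalIntegral.continuous_parametric_intervalIntegral_of_continuous' (by exact hc) 0 1)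
  | succ m ih =>
    intro F _ _ _ G hG
    have hc : Continuous G := hG.continuous
    have hG' : ContDiff ℝ (m + 1) G := by exact_mod_cast hG
    have hd : Differentiable ℝ G := hG'.differentiable (by simp)
    let L : (E × ℝ →L[ℝ] F) →L[ℝ] (E →L[ℝ] F) :=
      (ContinuousLinearMap.compL ℝ E (E × ℝ) F).flip (ContinuousLinearMap.inl ℝ E ℝ)
    let G' : E × ℝ → (E →L[ℝ] F) := fun p => L (fderiv ℝ G p)
    have hG's : ContDiff ℝ m G' := L.contDiff.comp (hG'.fderiv_right le_rfl)
    have hG'c : Continuous G' := hG's.continuous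
    have key : ContDiff ℝ (m + 1) (fun y => ∫ t in (0:ℝ)..1, G (y, t)) := by
      rw [contDiff_succ_iff_hasFDerivAt]
      refine ⟨fun y => ∫ t in (0:ℝ)..1, G' (y, t), ih G' hG's, fun x => ?_⟩
      obtain ⟨C, hC⟩ := ((isCompact_closedBall x 1).prod
        (isCompact_uIcc (a := (0:ℝ)) (b := 1))).exists_bound_of_continuousOn hG'c.continuousOn
      refine intervalIntegral.hasFDerivAt_integral_of_dominated_of_fderiv_le
        (F := fun y t => G (y, t)) (F' := fun y t => G' (y, t))
        (s := Metric.closedBall x 1) (bound := fun _ => C)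
        (Metric.closedBall_mem_nhds x one_pos) ?_ ?_ ?_ ?_ ?_ ?_
      · exact Eventually.of_forall fun y =>
          (by fun_prop : Continuous fun t => G (y, t)).aestronglyMeasurable
      · exact (by fun_prop : Continuous fun t => G (x, t)).intervalIntegrable _ _
      · exact (by fun_prop : Continuous fun t => G' (x, t)).aestronglyMeasurable
      · exact Eventually.of_forall fun t ht y hy => hC (y, t) ⟨hy, uIoc_subset_uIcc ht⟩
      · exact intervalIntegrable_const
      · refine Eventually.of_forall fun t _ y _ => ?_
        have h1 : HasFDerivAt (fun z : E => (z, t)) (ContinuousLinearMap.inl ℝ E ℝ) y :=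
          hasFDerivAt_prodMk_left y t
        exact (hd (y, t)).hasFDerivAt.comp y h1
    exact_mod_cast key

theorem hadamard_aux {n : ℕ} (F : (Fin n → ℝ) → ℝ) (hF : ContDiff ℝ (⊤ : ℕ∞) F)
    (x : Fin n → ℝ) : ∃ g : (Fin n → ℝ) → ((Fin n → ℝ) →L[ℝ] ℝ),
      ContDiff ℝ (⊤ : ℕ∞) g ∧ g x = fderiv ℝ F x ∧ ∀ y, F y = F x + g y (y - x) := by
  have hF' : ContDiff ℝ (⊤ : ℕ∞) (fderiv ℝ F) := hF.fderiv_right (by simp)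
  have hd : Differentiable ℝ F := hF.differentiable (by simp)
  have hG : ContDiff ℝ (⊤ : ℕ∞)
      (fun p : (Fin n → ℝ) × ℝ => fderiv ℝ F (x + p.2 • (p.1 - x))) :=
    hF'.comp (by fun_prop)
  refine ⟨fun y => ∫ t in (0:ℝ)..1, fderiv ℝ F (x + t • (y - x)), ?_, ?_, ?_⟩
  · exact contDiff_infty.2 fun m => contDiff_param_aux m _ (contDiff_infty.1 hG m)
  · simp
  · intro y
    have hc : Continuous fun t : ℝ => fderiv ℝ F (x + t • (y - x)) :=
      hF'.continuous.comp (by fun_prop)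
    have h1 : ∀ t : ℝ, HasDerivAt (fun t : ℝ => F (x + t • (y - x)))
        (fderiv ℝ F (x + t • (y - x)) (y - x)) t := by
      intro t
      have h2 : HasDerivAt (fun t : ℝ => x + t • (y - x)) (y - x) t := by
        simpa using ((hasDerivAt_id t).smul_const (y - x)).const_add x
      exact (hd _).hasFDerivAt.comp_hasDerivAt t h2
    have h3 := intervalIntegral.integral_eq_sub_of_hasDerivAt (a := 0) (b := 1)
      (fun t _ => h1 t) ((hc.clm_apply continuous_const).intervalIntegrable _ _)
    have h4 := ContinuousLinearMap.intervalIntegral_apply (hc.intervalIntegrable (μ := MeasureTheory.volume) 0 1) (y - x)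
    show F y = F x + (∫ t in (0:ℝ)..1, fderiv ℝ F (x + t • (y - x))) (y - x)
    rw [h4, h3]
    simp

theorem smoothOnSet_restrict {n : ℕ} (S : Set (Fin n → ℝ)) {F : (Fin n → ℝ) → ℝ}
    (hF : ContDiff ℝ (⊤ : ℕ∞) F) : SmoothOnSet S (fun y : S => F ↑y) :=
  fun _ => ⟨Set.univ, isOpen_univ, trivial, F, hF, fun _ _ => rfl⟩

theorem derivation_sum_aux {n : ℕ} (S : Set (Fin n → ℝ))
    (X : (S → ℝ) → (S → ℝ)) (hX : IsDerivationOn S X) {ι : Type} (s : Finset ι)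
    (H : ι → (Fin n → ℝ) → ℝ) (hH : ∀ i, ContDiff ℝ (⊤ : ℕ∞) (H i)) (x : S) :
    X (fun y : S => ∑ i ∈ s, H i ↑y) x = ∑ i ∈ s, X (fun y : S => H i ↑y) x := by
  classical
  obtain ⟨-, hadd, hsmul, -⟩ := hX
  induction s using Finset.induction_on with
  | empty =>
    have h := hsmul 0 (fun _ => 0) (smoothOnSet_restrict S (F := fun _ => 0) contDiff_const)
    have h0 : ((0:ℝ) • (fun _ => 0 : S → ℝ)) = fun _ => 0 := by ext; simp
    rw [h0] at h
    simp only [Finset.sum_empty]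
    rw [h]; simp
  | insert a s ha ih =>
    have h := hadd (fun y => H a ↑y) (fun y => ∑ i ∈ s, H i ↑y)
      (smoothOnSet_restrict S (hH a))
      (smoothOnSet_restrict S (F := fun y => ∑ i ∈ s, H i y) (ContDiff.sum fun i _ => hH i))
    simp only [Finset.sum_insert ha]
    rw [← ih]
    exact congrFun h x

theorem derivation_const_aux {n : ℕ} (S : Set (Fin n → ℝ))
    (X : (S → ℝ) → (S → ℝ)) (hX : IsDerivationOn S X) (c : ℝ) (x : S) :
    X (fun _ => c) x = 0 := by
  obtain ⟨-, -, hsmul, hmul⟩ := hX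
  have hs : SmoothOnSet S (fun _ => (1:ℝ)) :=
    smoothOnSet_restrict S (F := fun _ => 1) contDiff_const
  have h1 : X (fun _ => 1) x = 0 := by
    have h := congrFun (hmul _ _ hs hs) x
    have e : ((fun _ => 1 : S → ℝ) * fun _ => 1) = fun _ => 1 := by ext; simp
    rw [e] at h
    simp at h
    exact h
  have h := congrFun (hsmul c _ hs) x
  have e : (c • (fun _ => 1 : S → ℝ)) = fun _ => c := by ext; simp
  rw [e] at h
  rw [h]; simp [h1]

/-- for a derivation `X` of `C^∞(S)`, `S ⊆ ℝⁿ`, every `C^∞` function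
`F : ℝⁿ → ℝ` and every `x ∈ S`,
`X (F|_S) (x) = Σᵢ X (xⁱ|_S) (x) · (∂F/∂xⁱ)(x)`. -/
theorem derivationOn_eq_sum {n : ℕ} (S : Set (Fin n → ℝ))
    (X : (S → ℝ) → (S → ℝ)) (hX : IsDerivationOn S X)
    (F : (Fin n → ℝ) → ℝ) (hF : ContDiff ℝ (⊤ : ℕ∞) F) (x : S) :
    X (fun y : S => F ↑y) x =
      ∑ i : Fin n, X (fun y : S => (y : Fin n → ℝ) i) x *
        fderiv ℝ F (↑x) (Pi.single i 1) := by
  obtain ⟨g, hg, hgx, hgy⟩ := hadamard_aux F hF x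
  have hcoord : ∀ i : Fin n, ContDiff ℝ (⊤ : ℕ∞) (fun y : Fin n → ℝ => y i) :=
    fun i => contDiff_apply ℝ ℝ i
  have hA : ∀ i : Fin n, ContDiff ℝ (⊤ : ℕ∞) (fun y : Fin n → ℝ => y i + -(x : Fin n → ℝ) i) :=
    fun i => (hcoord i).add contDiff_const
  have hB : ∀ i : Fin n, ContDiff ℝ (⊤ : ℕ∞) (fun y : Fin n → ℝ => g y (Pi.single i 1)) :=
    fun i => hg.clm_apply contDiff_const
  let H : Fin n → (Fin n → ℝ) → ℝ :=
    fun i y => (y i + -(x : Fin n → ℝ) i) * g y (Pi.single i 1)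
  have hH : ∀ i, ContDiff ℝ (⊤ : ℕ∞) (H i) := fun i => (hA i).mul (hB i)
  have hFe : (fun y : S => F ↑y) =
      (fun _ : S => F x) + fun y : S => ∑ i, H i ↑y := by
    funext y
    rw [Pi.add_apply, hgy y]
    congr 1
    rw [← ContinuousLinearMap.coe_coe, LinearMap.pi_apply_eq_sum_univ]
    refine Finset.sum_congr rfl fun i _ => ?_
    have : (fun j => if i = j then (1:ℝ) else 0) = Pi.single i 1 := by
      ext j; simp [Pi.single_apply, eq_comm]
    rw [this]
    simp [H, sub_eq_add_neg]
  rw [hFe, hX.2.1 _ _ (smoothOnSet_restrict S (F := fun _ => F x) contDiff_const)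
    (smoothOnSet_restrict S (F := fun y => ∑ i, H i y) (ContDiff.sum fun i _ => hH i)),
    Pi.add_apply, derivation_const_aux S X hX, zero_add,
    derivation_sum_aux S X hX _ H hH]
  refine Finset.sum_congr rfl fun i _ => ?_
  have h1 := congrFun (hX.2.2.2 _ _ (smoothOnSet_restrict S (hA i))
    (smoothOnSet_restrict S (hB i))) x
  have h2 := congrFun (hX.2.1 _ _ (smoothOnSet_restrict S (hcoord i))
    (smoothOnSet_restrict S (F := fun _ => -(x : Fin n → ℝ) i) contDiff_const)) x
  rw [Pi.add_apply, derivation_const_aux S X hX, add_zero] at h2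
  refine h1.trans ?_
  rw [Pi.add_apply, Pi.mul_apply, Pi.mul_apply]
  rw [hgx, add_neg_cancel, zero_mul, add_zero]
  exact congrArg (· * _) h2
end

section
/- Let S ⊆ ℝⁿ be a closed subset and let X be a derivation of C^∞(S). Then there exist C^∞ functions F¹, ..., Fⁿ : ℝⁿ → ℝ such that the vector field Y = Σ_{i=1}^{n} Fⁱ ∂/∂xⁱ on ℝⁿ globally extends X: for every C^∞ function F : ℝⁿ → ℝ and every x ∈ S, X(F|_S)(x) = (Y F)(x) = Σ_{i=1}^{n} Fⁱ(x) (∂F/∂xⁱ)(x). -/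
open Set in
theorem aux_param {n : ℕ} (H : (Fin n → ℝ) × ℝ → ℝ) (hH : ContDiff ℝ (⊤ : ℕ∞) H) :
    ContDiff ℝ (⊤ : ℕ∞) (fun p => ∫ t in (0:ℝ)..1, H (p, t)) := by
  let φ : ContDiffBump (0:ℝ) := ⟨1, 2, by norm_num, by norm_num⟩
  let g : (Fin n → ℝ) → ℝ → ℝ := fun p s => φ s * H (p, -s)
  let f : ℝ → ℝ := (Ioc (0:ℝ) 1).indicator 1
  have hg : ContDiff ℝ (⊤ : ℕ∞) (fun q : (Fin n → ℝ) × ℝ => φ q.2 * H (q.1, -q.2)) :=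
    (φ.contDiff.comp contDiff_snd).mul (hH.comp (contDiff_fst.prodMk contDiff_snd.neg))
  have hf : MeasureTheory.LocallyIntegrable f := by
    apply MeasureTheory.Integrable.locallyIntegrable
    apply (MeasureTheory.integrable_indicator_iff measurableSet_Ioc).2
    change MeasureTheory.IntegrableOn (fun _ => (1:ℝ)) _ _
    simp
  have key := MeasureTheory.contDiffOn_convolution_right_with_param_comp (𝕜 := ℝ) (n := ⊤)
    (μ := MeasureTheory.volume)
    (ContinuousLinearMap.lsmul ℝ ℝ : ℝ →L[ℝ] ℝ →L[ℝ] ℝ) (s := (univ : Set (Fin n → ℝ)))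
    (v := fun _ => (0:ℝ)) contDiffOn_const (f := f) (g := g) (k := Metric.closedBall 0 2)
    isOpen_univ (isCompact_closedBall _ _) ?_ hf ?_
  · rw [contDiffOn_univ] at key
    convert key using 2 with p
    rw [MeasureTheory.convolution_def, intervalIntegral.integral_of_le zero_le_one,
      ← MeasureTheory.integral_indicator measurableSet_Ioc]
    congr 1
    ext t
    by_cases ht : t ∈ Ioc (0:ℝ) 1
    · have : φ (-t) = 1 := by
        apply φ.one_of_mem_closedBall
        simp only [mem_closedBall_zero_iff, norm_neg, Real.norm_eq_abs]
        rw [abs_of_pos ht.1]; exact ht.2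
      simp [f, g, ht, this]
    · simp [f, ht]
  · intro p x _ hx
    have : φ x = 0 := by
      apply φ.zero_of_le_dist
      simp only [Metric.mem_closedBall, not_le] at hx
      exact hx.le
    simp [g, this]
  · exact hg.contDiffOn

theorem aux_hadamard {n : ℕ} (F : (Fin n → ℝ) → ℝ) (hF : ContDiff ℝ (⊤ : ℕ∞) F)
    (a : Fin n → ℝ) :
    ∃ g : Fin n → (Fin n → ℝ) → ℝ, (∀ i, ContDiff ℝ (⊤ : ℕ∞) (g i)) ∧
      (∀ i, g i a = fderiv ℝ F a (Pi.single i 1)) ∧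
      ∀ y, F y = F a + ∑ i, (y i - a i) * g i y := by
  have hd : ContDiff ℝ (⊤ : ℕ∞) (fderiv ℝ F) := hF.fderiv_right (by simp)
  have hdiff : Differentiable ℝ F := hF.differentiable (by simp)
  refine ⟨fun i y => ∫ t in (0:ℝ)..1, fderiv ℝ F (a + t • (y - a)) (Pi.single i 1), ?_, ?_, ?_⟩
  · intro i
    apply aux_param (fun q => fderiv ℝ F (a + q.2 • (q.1 - a)) (Pi.single i 1))
    apply ContDiff.clm_apply _ contDiff_const
    apply hd.comp
    fun_prop
  · intro i; simp
  · intro y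
    have h1 : ∫ t in (0:ℝ)..1, fderiv ℝ F (a + t • (y - a)) (y - a) = F y - F a := by
      have hc : Continuous fun t : ℝ => fderiv ℝ F (a + t • (y - a)) (y - a) :=
        (hd.continuous.comp (by fun_prop)).clm_apply continuous_const
      have := intervalIntegral.integral_eq_sub_of_hasDerivAt (a := 0) (b := 1)
        (f := fun t : ℝ => F (a + t • (y - a)))
        (f' := fun t : ℝ => fderiv ℝ F (a + t • (y - a)) (y - a)) ?_ (hc.intervalIntegrable _ _)
      · simpa using this
      · intro t _
        have h2 : HasDerivAt (fun t : ℝ => a + t • (y - a)) (y - a) t := by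
          simpa using ((hasDerivAt_id t).smul_const (y - a)).const_add a
        exact (hdiff _).hasFDerivAt.comp_hasDerivAt t h2
    have h3 : ∀ t : ℝ, fderiv ℝ F (a + t • (y - a)) (y - a)
        = ∑ i, (y i - a i) * fderiv ℝ F (a + t • (y - a)) (Pi.single i 1) := by
      intro t
      have h4 : ∀ L : (Fin n → ℝ) →L[ℝ] ℝ, L (y - a) = ∑ i, (y i - a i) * L (Pi.single i 1) := by
        intro L
        conv_lhs => rw [← Finset.univ_sum_single (y - a)]
        rw [map_sum]
        refine Finset.sum_congr rfl fun i _ => ?_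
        rw [← smul_eq_mul, ← map_smul, ← Pi.single_smul]
        simp
      exact h4 _
    simp_rw [h3] at h1
    rw [intervalIntegral.integral_finsetSum] at h1
    · simp_rw [intervalIntegral.integral_const_mul] at h1
      linarith
    · intro i _
      apply Continuous.intervalIntegrable
      exact continuous_const.mul
        ((hd.continuous.comp (by fun_prop)).clm_apply continuous_const)

open scoped Manifold ContDiff Topology in
theorem aux_extend {n : ℕ} (S : Set (Fin n → ℝ)) (hS : IsClosed S) (f : S → ℝ)
    (hf : SmoothOnSet S f) :
    ∃ G : (Fin n → ℝ) → ℝ, ContDiff ℝ (⊤ : ℕ∞) G ∧ ∀ x : S, G x = f x := by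
  have hconv : ∀ x : Fin n → ℝ, Convex ℝ {r : ℝ | ∀ h : x ∈ S, r = f ⟨x, h⟩} := by
    intro x
    by_cases h : x ∈ S
    · simp [h]
    · simpa [h] using convex_univ
  obtain ⟨g, hg⟩ := exists_contMDiffMap_forall_mem_convex_of_local (n := (⊤ : ℕ∞))
    (M := Fin n → ℝ) (F := ℝ) 𝓘(ℝ, Fin n → ℝ)
    (t := fun x => {r : ℝ | ∀ h : x ∈ S, r = f ⟨x, h⟩}) hconv (by
      intro x
      by_cases h : x ∈ S
      · obtain ⟨U, hU, hx, F, hF, hFf⟩ := hf ⟨x, h⟩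
        exact ⟨U, hU.mem_nhds hx, F, hF.contMDiff.contMDiffOn,
          fun y hy hyS => hFf ⟨y, hyS⟩ hy⟩
      · exact ⟨Sᶜ, hS.isOpen_compl.mem_nhds h, fun _ => 0, contMDiffOn_const,
          fun y hy hyS => absurd hyS hy⟩)
  exact ⟨g, g.contMDiff.contDiff, fun x => hg x x.2⟩

theorem aux_smooth {n : ℕ} (S : Set (Fin n → ℝ)) (F : (Fin n → ℝ) → ℝ)
    (hF : ContDiff ℝ (⊤ : ℕ∞) F) : SmoothOnSet S (fun z : S => F z) :=
  fun _ => ⟨Set.univ, isOpen_univ, trivial, F, hF, fun _ _ => rfl⟩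

/-- if `S ⊆ ℝⁿ` is closed, every derivation of `C^∞(S)` extends to a
global `C^∞` vector field `Y = Σᵢ Fⁱ ∂/∂xⁱ` on `ℝⁿ`: there are
`F¹, …, Fⁿ ∈ C^∞(ℝⁿ, ℝ)` such that `X (F|_S) (x) = Σᵢ Fⁱ(x) (∂F/∂xⁱ)(x)`
for every `C^∞` `F : ℝⁿ → ℝ` and every `x ∈ S`. -/
theorem derivationOn_globally_extends_of_isClosed {n : ℕ} (S : Set (Fin n → ℝ))
    (hS : IsClosed S) (X : (S → ℝ) → (S → ℝ)) (hX : IsDerivationOn S X) :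
    ∃ G : Fin n → ((Fin n → ℝ) → ℝ), (∀ i, ContDiff ℝ (⊤ : ℕ∞) (G i)) ∧
      ∀ F : (Fin n → ℝ) → ℝ, ContDiff ℝ (⊤ : ℕ∞) F →
        ∀ x : S,
          X (fun z : S => F ↑z) x =
            ∑ i : Fin n, G i ↑x * fderiv ℝ F (↑x) (Pi.single i 1) := by
  obtain ⟨h1, h2, h3, h4⟩ := hX
  have hco : ∀ i, ContDiff ℝ (⊤ : ℕ∞) (fun y : Fin n → ℝ => y i) := fun i => contDiff_apply ℝ ℝ i
  have hext := fun i => aux_extend S hS _ (h1 _ (aux_smooth S _ (hco i)))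
  choose G hG hGX using hext
  refine ⟨G, hG, fun F hF x => ?_⟩
  -- additivity and Leibniz rule on restrictions
  have hadd : ∀ A B : (Fin n → ℝ) → ℝ, ContDiff ℝ (⊤ : ℕ∞) A → ContDiff ℝ (⊤ : ℕ∞) B →
      X (fun z : S => A z + B z) x = X (fun z : S => A z) x + X (fun z : S => B z) x :=
    fun A B hA hB => congrFun (h2 _ _ (aux_smooth S A hA) (aux_smooth S B hB)) x
  have hmul : ∀ A B : (Fin n → ℝ) → ℝ, ContDiff ℝ (⊤ : ℕ∞) A → ContDiff ℝ (⊤ : ℕ∞) B →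
      X (fun z : S => A z * B z) x
        = X (fun z : S => A z) x * B x + A x * X (fun z : S => B z) x :=
    fun A B hA hB => congrFun (h4 _ _ (aux_smooth S A hA) (aux_smooth S B hB)) x
  have hone : X (fun _ : S => 1) x = 0 := by
    have := hmul (fun _ => 1) (fun _ => 1) contDiff_const contDiff_const
    simp only [mul_one, one_mul] at this
    linarith
  have hconst : ∀ c : ℝ, X (fun _ : S => c) x = 0 := by
    intro c
    have := congrFun (h3 c _ (aux_smooth S (fun _ => 1) contDiff_const)) x
    have e : (c • fun _ : S => (1:ℝ)) = fun _ => c := by ext; simp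
    rw [e] at this
    simpa [hone] using this
  obtain ⟨g, hg, hga, hgF⟩ := aux_hadamard F hF x
  have hsub : ∀ i, ContDiff ℝ (⊤ : ℕ∞) (fun y : Fin n → ℝ => y i + -(x : Fin n → ℝ) i) :=
    fun i => (hco i).add contDiff_const
  have hterm : ∀ i, ContDiff ℝ (⊤ : ℕ∞)
      (fun y : Fin n → ℝ => (y i + -(x : Fin n → ℝ) i) * g i y) :=
    fun i => (hsub i).mul (hg i)
  have hsum : ∀ s : Finset (Fin n),
      X (fun z : S => ∑ i ∈ s, ((z : Fin n → ℝ) i + -(x : Fin n → ℝ) i) * g i z) x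
        = ∑ i ∈ s, G i x * fderiv ℝ F x (Pi.single i 1) := by
    intro s
    induction s using Finset.induction_on with
    | empty => simpa using hconst 0
    | insert j s hj ih =>
      simp_rw [Finset.sum_insert hj]
      rw [hadd (fun y => (y j + -(x : Fin n → ℝ) j) * g j y)
        (fun y => ∑ i ∈ s, (y i + -(x : Fin n → ℝ) i) * g i y) (hterm j)
        (ContDiff.sum fun i _ => hterm i), ih,
        hmul (fun y => y j + -(x : Fin n → ℝ) j) (g j) (hsub j) (hg j),
        hadd (fun y => y j) (fun _ => -(x : Fin n → ℝ) j) (hco j) contDiff_const,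
        hconst, hga, hGX]
      ring
  have e : (fun z : S => F z) = fun z : S => F x +
      ∑ i, ((z : Fin n → ℝ) i + -(x : Fin n → ℝ) i) * g i z := by
    ext z
    simpa [sub_eq_add_neg] using hgF z
  rw [e, hadd (fun _ => F x) (fun y => ∑ i, (y i + -(x : Fin n → ℝ) i) * g i y) contDiff_const
    (ContDiff.sum fun i _ => hterm i), hconst, hsum, zero_add]
end

section
/- Let S ⊆ ℝⁿ, let Y be a C^∞ vector field on ℝⁿ, and let X be a derivation of C^∞(S) such that X(F|_S) = (Y F)|_S for every C^∞ function F : ℝⁿ → ℝ. Let z ∈ S, let c₀ be the integral curve of Y in ℝⁿ with c₀(0) = z, and let I be the connected component of c₀⁻¹(S) containing 0. If I ≠ {0}, then c = c₀|_I : I → S is an integral curve of X starting at z: for every f ∈ C^∞(S) and every t₀ ∈ I, the function t ↦ f(c(t)) is differentiable at t₀ with derivative X(f)(c(t₀)). -/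
open Classical

/-- let `Y` be a `C^∞` vector field on `ℝⁿ` and `X` a derivation of
`C^∞(S)` with `X (F|_S) = (Y F)|_S` for all `C^∞` `F : ℝⁿ → ℝ`.  Let `c₀` be the
integral curve of `Y` with `c₀ 0 = z ∈ S`, and let `I` be the connected component
of `c₀ ⁻¹' S` containing `0`.  If `I ≠ {0}`, then the restriction `c = c₀|_I`,
viewed as a curve in `S`, is an integral curve of `X` starting at `z`: for every
smooth `f` on `S` and every `t₀ ∈ I`, the function `t ↦ f (c t)` is differentiable
(within `I`) at `t₀` with derivative `X f (c t₀)`. -/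
theorem integralCurve_of_restriction {n : ℕ} (S : Set (Fin n → ℝ))
    (Y : (Fin n → ℝ) → (Fin n → ℝ)) (hY : ContDiff ℝ (⊤ : ℕ∞) Y)
    (X : (S → ℝ) → (S → ℝ)) (hX : IsDerivationOn S X)
    (hXY : ∀ F : (Fin n → ℝ) → ℝ, ContDiff ℝ (⊤ : ℕ∞) F →
      X (fun y : S => F ↑y) = fun y : S => fderiv ℝ F ↑y (Y ↑y))
    (z : Fin n → ℝ) (hz : z ∈ S)
    (c₀ : ℝ → (Fin n → ℝ)) (hc₀ : c₀ 0 = z)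
    (hode : ∀ t : ℝ, HasDerivAt c₀ (Y (c₀ t)) t)
    (hne : connectedComponentIn (c₀ ⁻¹' S) 0 ≠ {0}) :
    ∀ f : S → ℝ, SmoothOnSet S f →
      ∀ t₀ : ℝ, ∀ ht₀ : t₀ ∈ connectedComponentIn (c₀ ⁻¹' S) 0,
        HasDerivWithinAt
          (fun t : ℝ =>
            if ht : t ∈ connectedComponentIn (c₀ ⁻¹' S) 0 then
              f ⟨c₀ t, connectedComponentIn_subset (c₀ ⁻¹' S) 0 ht⟩
            else 0)
          (X f ⟨c₀ t₀, connectedComponentIn_subset (c₀ ⁻¹' S) 0 ht₀⟩)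
          (connectedComponentIn (c₀ ⁻¹' S) 0) t₀ := by
  intro f hf t₀ ht₀
  have hres : ∀ F : (Fin n → ℝ) → ℝ, ContDiff ℝ (⊤ : ℕ∞) F →
      SmoothOnSet S (fun y : S => F ↑y) := fun F hF x =>
    ⟨Set.univ, isOpen_univ, trivial, F, hF, fun _ _ => rfl⟩
  set x : S := ⟨c₀ t₀, connectedComponentIn_subset (c₀ ⁻¹' S) 0 ht₀⟩ with hx
  obtain ⟨U, hU, hxU, F, hF, hFf⟩ := hf x
  obtain ⟨φ, hsupp, -, hφ, -, hφx⟩ :=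
    exists_contDiff_tsupport_subset (n := (⊤ : ℕ∞)) (hU.mem_nhds hxU)
  have heq : (fun y : S => φ ↑y) * f = (fun y : S => φ ↑y) * (fun y : S => F ↑y) := by
    funext y
    by_cases hy : (y : Fin n → ℝ) ∈ U
    · simp [hFf y hy]
    · have h0 : φ (y : Fin n → ℝ) = 0 := by
        by_contra h
        exact hy (hsupp (subset_tsupport φ h))
      simp [h0]
  have h1 := hX.2.2.2 _ f (hres φ hφ) hf
  have h2 := hX.2.2.2 _ _ (hres φ hφ) (hres F hF)
  rw [heq, h2] at h1
  have h3 := congrFun h1 x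
  simp only [Pi.add_apply, Pi.mul_apply, hφx, hFf x hxU, one_mul, add_right_inj] at h3
  rw [← h3, hXY F hF]
  have hd : HasDerivAt (fun t => F (c₀ t)) (fderiv ℝ F (c₀ t₀) (Y (c₀ t₀))) t₀ :=
    ((hF.differentiable (by simp)) (c₀ t₀)).hasFDerivAt.comp_hasDerivAt t₀ (hode t₀)
  refine hd.hasDerivWithinAt.congr_of_eventuallyEq ?_ ?_
  · have hn : ∀ᶠ t in nhdsWithin t₀ (connectedComponentIn (c₀ ⁻¹' S) 0), c₀ t ∈ U :=
      ((hode t₀).continuousAt.eventually (hU.mem_nhds hxU)).filter_mono nhdsWithin_le_nhds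
    filter_upwards [hn, self_mem_nhdsWithin] with t htU htI
    rw [dif_pos htI]
    exact (hFf ⟨c₀ t, connectedComponentIn_subset (c₀ ⁻¹' S) 0 htI⟩ htU).symm
  · rw [dif_pos ht₀]
    exact (hFf x hxU).symm
end
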